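/- arXiv:1903.03106 — 2 statements merged into one kernel-verified Lean document; each statement's English description precedes it below -/
import Mathlib

section
/- Let K be an origin-symmetric convex body in R^d that is a generating set, and let A ⊂ R^d be a nonempty compact set with V_d(A) > 0. Then for all r > r_K(A), V_d(A_K^r) ≤ V_d(B_K[o, r − r_K(A)]) = (r − r_K(A))^d V_d(K), where r_K(A) is the volumetric radius of A relative to K. In other words, the balls of the Minkowski space generated by K are volumetric maximizers for r-ball bodies. -/
open MeasureTheory Set
open scoped Pointwise
open scoped ENNReal

theorem IsCompact.volume_add_le_volume_add {P Q : Set ℝ} (hP : IsCompact P) (hQ : IsCompact Q)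
    (hPne : P.Nonempty) (hQne : Q.Nonempty) :
    volume P + volume Q ≤ volume (P + Q) := by
  obtain ⟨p, hp, hpmax⟩ := hP.exists_isGreatest hPne
  obtain ⟨q, hq, hqmin⟩ := hQ.exists_isLeast hQne
  have hdisj : AEDisjoint volume ((q + ·) '' P) ((p + ·) '' Q) := by
    refine measure_mono_null ?_ (measure_singleton (p + q))
    rintro _ ⟨⟨x, hx, rfl⟩, ⟨y, hy, hxy⟩⟩
    have h₁ := hpmax hx
    have h₂ := hqmin hy
    simp only at hxy
    rw [mem_singleton_iff]
    linarith
  have hQmeas : NullMeasurableSet ((p + ·) '' Q) :=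
    (hQ.image (continuous_const_add p)).measurableSet.nullMeasurableSet
  calc volume P + volume Q = volume ((q + ·) '' P) + volume ((p + ·) '' Q) := by
        simp [image_add_left, measure_preimage_add]
    _ = volume ((q + ·) '' P ∪ (p + ·) '' Q) := (measure_union₀ hQmeas hdisj).symm
    _ ≤ volume (P + Q) := by
        refine measure_mono (union_subset ?_ ?_)
        · rintro _ ⟨x, hx, rfl⟩
          exact ⟨x, hx, q, hq, add_comm _ _⟩
        · rintro _ ⟨y, hy, rfl⟩
          exact ⟨p, hp, y, hy, rfl⟩

/-- The one-dimensional Brunn–Minkowski inequality. -/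
theorem MeasurableSet.volume_add_le_volume_add {P Q : Set ℝ} (hP : MeasurableSet P)
    (hQ : MeasurableSet Q) (hPne : P.Nonempty) (hQne : Q.Nonempty) :
    volume P + volume Q ≤ volume (P + Q) := by
  obtain ⟨p, hp⟩ := hPne
  obtain ⟨q, hq⟩ := hQne
  have key : ∀ S, (S ⊆ P ∧ IsCompact S) → ∀ T, (T ⊆ Q ∧ IsCompact T) →
      volume S + volume T ≤ volume (P + Q) := by
    rintro S ⟨hSP, hS⟩ T ⟨hTQ, hT⟩
    calc volume S + volume T ≤ volume (insert p S) + volume (insert q T) := by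
          gcongr <;> exact subset_insert _ _
      _ ≤ volume (insert p S + insert q T) :=
          (hS.insert p).volume_add_le_volume_add (hT.insert q) (insert_nonempty _ _)
            (insert_nonempty _ _)
      _ ≤ volume (P + Q) := by
          gcongr
          · exact insert_subset hp hSP
          · exact insert_subset hq hTQ
  rw [hP.measure_eq_iSup_isCompact, hQ.measure_eq_iSup_isCompact]
  rw [iSup_congr fun S ↦ (iSup_and' (p := S ⊆ P)), iSup_congr fun T ↦ (iSup_and' (p := T ⊆ Q))]
  exact ENNReal.biSup_add_biSup_le' ⟨∅, empty_subset _, isCompact_empty⟩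
    ⟨∅, empty_subset _, isCompact_empty⟩ key

theorem lintegral_eq_lintegral_Ioo_meas_lt {F : ℝ → ℝ≥0∞} (hF : Measurable F) (hF1 : ∀ x, F x ≤ 1) :
    ∫⁻ x, F x = ∫⁻ s in Ioo (0 : ℝ) 1, volume {x | ENNReal.ofReal s < F x} := by
  have hfin : ∀ x, F x ≠ ∞ := fun x ↦ ((hF1 x).trans_lt ENNReal.one_lt_top).ne
  have hcake := lintegral_eq_lintegral_meas_lt (volume : Measure ℝ) (f := fun x ↦ (F x).toReal)
    (.of_forall fun x ↦ ENNReal.toReal_nonneg) hF.ennreal_toReal.aemeasurable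
  simp only [ENNReal.ofReal_toReal (hfin _)] at hcake
  rw [hcake, ← Ioo_union_Ici_eq_Ioi zero_lt_one,
    lintegral_union measurableSet_Ici (Set.disjoint_left.2 fun s hs hs' ↦ hs.2.not_ge hs'),
    setLIntegral_congr_fun (s := Ici 1) (g := fun _ ↦ 0) measurableSet_Ici]
  · rw [lintegral_zero, add_zero]
    refine setLIntegral_congr_fun measurableSet_Ioo fun s hs ↦ ?_
    simp only [ENNReal.ofReal_lt_iff_lt_toReal hs.1.le (hfin _)]
  · intro s hs
    have hempty : {x | s < (F x).toReal} = ∅ := by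
      ext x
      simpa using (ENNReal.toReal_mono ENNReal.one_ne_top (hF1 x)).trans hs
    simp [hempty]

namespace ENNReal

theorem geom_mean_le_arith_mean2_weighted {t : ℝ} (ht0 : 0 < t) (ht1 : t < 1) (a b : ℝ≥0∞) :
    a ^ (1 - t) * b ^ t ≤ ENNReal.ofReal (1 - t) * a + ENNReal.ofReal t * b := by
  have hs : 0 < 1 - t := sub_pos.2 ht1
  rcases eq_or_ne a ∞ with rfl | ha
  · simp [ENNReal.mul_top (ENNReal.ofReal_pos.2 hs).ne']
  rcases eq_or_ne b ∞ with rfl | hb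
  · simp [ENNReal.mul_top (ENNReal.ofReal_pos.2 ht0).ne']
  lift a to NNReal using ha
  lift b to NNReal using hb
  have h := NNReal.geom_mean_le_arith_mean2_weighted (1 - t).toNNReal t.toNNReal a b
    (by rw [← Real.toNNReal_add hs.le ht0.le]; simp)
  rw [Real.coe_toNNReal _ hs.le, Real.coe_toNNReal _ ht0.le] at h
  rw [← ENNReal.coe_rpow_of_nonneg _ hs.le, ← ENNReal.coe_rpow_of_nonneg _ ht0.le,
    ENNReal.ofReal, ENNReal.ofReal]
  exact_mod_cast h

theorem min_le_rpow_mul_rpow {t : ℝ} (ht0 : 0 < t) (ht1 : t < 1) (a b : ℝ≥0∞) :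
    min a b ≤ a ^ (1 - t) * b ^ t := by
  have hs : 0 < 1 - t := sub_pos.2 ht1
  calc min a b = min a b ^ (1 - t) * min a b ^ t := by
        rw [← ENNReal.rpow_add_of_nonneg _ _ hs.le ht0.le, sub_add_cancel, ENNReal.rpow_one]
    _ ≤ a ^ (1 - t) * b ^ t := by
        gcongr
        · exact min_le_left _ _
        · exact min_le_right _ _

theorem iSup_rpow {ι : Sort*} {t : ℝ} (ht : 0 < t) (u : ι → ℝ≥0∞) :
    (⨆ i, u i) ^ t = ⨆ i, u i ^ t :=
  (ENNReal.orderIsoRpow t ht).map_iSup u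

end ENNReal

theorem lintegral_add_lintegral_le_of_min_le {t : ℝ} (ht0 : 0 < t) (ht1 : t < 1)
    {f g h : ℝ → ℝ≥0∞} (hf : Measurable f) (hg : Measurable g) (hh : Measurable h)
    (hf1 : ⨆ x, f x = 1) (hg1 : ⨆ x, g x = 1)
    (hfgh : ∀ x y, min (f x) (g y) ≤ h ((1 - t) * x + t * y)) :
    ENNReal.ofReal (1 - t) * (∫⁻ x, f x) + ENNReal.ofReal t * (∫⁻ x, g x) ≤ ∫⁻ x, h x := by
  have hs : 0 < 1 - t := sub_pos.2 ht1
  have hmeas : ∀ F : ℝ → ℝ≥0∞, Measurable fun s : ℝ ↦ volume {x | ENNReal.ofReal s < F x} :=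
    fun F ↦ Antitone.measurable fun s s' hss' ↦ measure_mono fun x hx ↦
      (ENNReal.ofReal_le_ofReal hss').trans_lt hx
  refine le_trans ?_ (lintegral_mono fun x ↦ min_le_left (h x) 1)
  rw [lintegral_eq_lintegral_Ioo_meas_lt hf fun x ↦ hf1 ▸ le_iSup f x,
    lintegral_eq_lintegral_Ioo_meas_lt hg fun x ↦ hg1 ▸ le_iSup g x,
    lintegral_eq_lintegral_Ioo_meas_lt (hh.min measurable_const) fun x ↦ min_le_right _ _,
    ← lintegral_const_mul _ (hmeas f), ← lintegral_const_mul _ (hmeas g),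
    ← lintegral_add_left ((hmeas f).const_mul _)]
  refine setLIntegral_mono (hmeas _) fun s hs01 ↦ ?_
  have hs1 : ENNReal.ofReal s < 1 := by simpa using hs01.2
  have hP : MeasurableSet {x | ENNReal.ofReal s < f x} := measurableSet_lt measurable_const hf
  have hQ : MeasurableSet {x | ENNReal.ofReal s < g x} := measurableSet_lt measurable_const hg
  have hPne : {x | ENNReal.ofReal s < f x}.Nonempty := lt_iSup_iff.1 (hs1.trans_eq hf1.symm)
  have hQne : {x | ENNReal.ofReal s < g x}.Nonempty := lt_iSup_iff.1 (hs1.trans_eq hg1.symm)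
  have hBM := (hP.const_smul₀ (1 - t)).volume_add_le_volume_add (hQ.const_smul₀ t)
    hPne.smul_set hQne.smul_set
  rw [Measure.addHaar_smul_of_nonneg _ hs.le, Measure.addHaar_smul_of_nonneg _ ht0.le,
    Module.finrank_self, pow_one, pow_one] at hBM
  refine hBM.trans (measure_mono ?_)
  rintro _ ⟨_, ⟨x, hx, rfl⟩, _, ⟨y, hy, rfl⟩, rfl⟩
  exact lt_min ((lt_min hx hy).trans_le (hfgh x y)) hs1

theorem prekopa_leindler_real_of_bounded {t : ℝ} (ht0 : 0 < t) (ht1 : t < 1)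
    {f g h : ℝ → ℝ≥0∞} (hf : Measurable f) (hg : Measurable g) (hh : Measurable h)
    (hfb : ⨆ x, f x ≠ ∞) (hgb : ⨆ x, g x ≠ ∞)
    (hfgh : ∀ x y, f x ^ (1 - t) * g y ^ t ≤ h ((1 - t) * x + t * y)) :
    (∫⁻ x, f x) ^ (1 - t) * (∫⁻ x, g x) ^ t ≤ ∫⁻ x, h x := by
  have hs : 0 < 1 - t := sub_pos.2 ht1
  set M := ⨆ x, f x with hM
  set N := ⨆ x, g x with hN
  rcases eq_or_ne M 0 with hM0 | hM0
  · have hf0 : ∀ x, f x = 0 := ENNReal.iSup_eq_zero.1 hM0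
    simp [hf0, hs]
  rcases eq_or_ne N 0 with hN0 | hN0
  · have hg0 : ∀ x, g x = 0 := ENNReal.iSup_eq_zero.1 hN0
    simp [hg0, ht0]
  have hMt0 : M ^ (1 - t) ≠ 0 := (ENNReal.rpow_pos (pos_iff_ne_zero.2 hM0) hfb).ne'
  have hNt0 : N ^ t ≠ 0 := (ENNReal.rpow_pos (pos_iff_ne_zero.2 hN0) hgb).ne'
  have hMt : M ^ (1 - t) ≠ ∞ := ENNReal.rpow_ne_top_of_nonneg hs.le hfb
  have hNt : N ^ t ≠ ∞ := ENNReal.rpow_ne_top_of_nonneg ht0.le hgb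
  have hC0 : M ^ (1 - t) * N ^ t ≠ 0 := mul_ne_zero hMt0 hNt0
  have hC : M ^ (1 - t) * N ^ t ≠ ∞ := ENNReal.mul_ne_top hMt hNt
  have hdiv : ∀ a b : ℝ≥0∞, (a / M) ^ (1 - t) * (b / N) ^ t =
      a ^ (1 - t) * b ^ t / (M ^ (1 - t) * N ^ t) := fun a b ↦ by
    rw [ENNReal.div_rpow_of_nonneg _ _ hs.le, ENNReal.div_rpow_of_nonneg _ _ ht0.le,
      ENNReal.div_eq_inv_mul, ENNReal.div_eq_inv_mul, ENNReal.div_eq_inv_mul,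
      ENNReal.mul_inv (.inl hMt0) (.inl hMt)]
    ring
  have key := lintegral_add_lintegral_le_of_min_le ht0 ht1 (hf.div_const M) (hg.div_const N)
    (hh.div_const (M ^ (1 - t) * N ^ t))
    (by rw [← ENNReal.iSup_div, ← hM, ENNReal.div_self hM0 hfb])
    (by rw [← ENNReal.iSup_div, ← hN, ENNReal.div_self hN0 hgb])
    (fun x y ↦ (ENNReal.min_le_rpow_mul_rpow ht0 ht1 _ _).trans <| by
      rw [hdiv]
      exact ENNReal.div_le_div_right (hfgh x y) _)
  replace key := (ENNReal.geom_mean_le_arith_mean2_weighted ht0 ht1 _ _).trans key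
  simp only [div_eq_mul_inv] at key
  rw [lintegral_mul_const _ hf, lintegral_mul_const _ hg, lintegral_mul_const _ hh] at key
  simp only [← div_eq_mul_inv] at key
  rw [hdiv] at key
  simpa only [ENNReal.div_mul_cancel hC0 hC] using mul_le_mul_left key (M ^ (1 - t) * N ^ t)

theorem lintegral_eq_iSup_lintegral_min_natCast {α : Type*} [MeasurableSpace α] {μ : Measure α}
    {f : α → ℝ≥0∞} (hf : Measurable f) :
    ∫⁻ x, f x ∂μ = ⨆ n : ℕ, ∫⁻ x, min (f x) n ∂μ := by
  rw [← lintegral_iSup (fun n ↦ hf.min measurable_const)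
    fun n m hnm x ↦ min_le_min_left _ (Nat.cast_le.2 hnm)]
  refine lintegral_congr fun x ↦ ?_
  rw [← inf_iSup_eq, ENNReal.iSup_natCast, inf_top_eq]

theorem prekopa_leindler_real {t : ℝ} (ht0 : 0 < t) (ht1 : t < 1)
    {f g h : ℝ → ℝ≥0∞} (hf : Measurable f) (hg : Measurable g) (hh : Measurable h)
    (hfgh : ∀ x y, f x ^ (1 - t) * g y ^ t ≤ h ((1 - t) * x + t * y)) :
    (∫⁻ x, f x) ^ (1 - t) * (∫⁻ x, g x) ^ t ≤ ∫⁻ x, h x := by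
  have hs : 0 < 1 - t := sub_pos.2 ht1
  rw [lintegral_eq_iSup_lintegral_min_natCast hf, lintegral_eq_iSup_lintegral_min_natCast hg,
    ENNReal.iSup_rpow hs, ENNReal.iSup_rpow ht0, ENNReal.iSup_mul]
  refine iSup_le fun n ↦ ?_
  rw [ENNReal.mul_iSup]
  refine iSup_le fun m ↦ ?_
  have hbdd : ∀ (F : ℝ → ℝ≥0∞) (k : ℕ), ⨆ x, min (F x) k ≠ ∞ := fun F k ↦
    ((iSup_le fun x ↦ min_le_right _ _).trans_lt (ENNReal.natCast_lt_top k)).ne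
  refine prekopa_leindler_real_of_bounded ht0 ht1 (hf.min measurable_const)
    (hg.min measurable_const) hh (hbdd f n) (hbdd g m) fun x y ↦ le_trans ?_ (hfgh x y)
  gcongr <;> exact min_le_left _ _

/-- The **Prékopa–Leindler inequality**. -/
theorem prekopa_leindler {t : ℝ} (ht0 : 0 < t) (ht1 : t < 1) {n : ℕ}
    {f g h : (Fin n → ℝ) → ℝ≥0∞} (hf : Measurable f) (hg : Measurable g) (hh : Measurable h)
    (hfgh : ∀ x y, f x ^ (1 - t) * g y ^ t ≤ h ((1 - t) • x + t • y)) :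
    (∫⁻ x, f x) ^ (1 - t) * (∫⁻ x, g x) ^ t ≤ ∫⁻ x, h x := by
  induction n with
  | zero =>
    simpa [Measure.volume_pi_eq_dirac (0 : Fin 0 → ℝ)] using hfgh 0 0
  | succ n ih =>
    have hcons : Measurable fun p : ℝ × (Fin n → ℝ) ↦ (Fin.cons p.1 p.2 : Fin (n + 1) → ℝ) :=
      measurable_pi_lambda _ <| Fin.cases (by simpa using measurable_fst) fun i ↦ by
        simpa using measurable_snd.eval
    have hfubini : ∀ F : (Fin (n + 1) → ℝ) → ℝ≥0∞, Measurable F →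
        ∫⁻ x, F x = ∫⁻ a : ℝ, ∫⁻ v : Fin n → ℝ, F (Fin.cons a v) := fun F hF ↦ by
      rw [← (volume_preserving_piFinSuccAbove (fun _ : Fin (n + 1) ↦ ℝ) 0).symm.lintegral_comp hF]
      refine (lintegral_congr fun p ↦ ?_).trans
        (lintegral_prod (F ∘ fun p ↦ Fin.cons p.1 p.2) (hF.comp hcons).aemeasurable)
      exact congrArg F (Fin.insertNth_zero' p.1 p.2)
    have hmeas : ∀ F : (Fin (n + 1) → ℝ) → ℝ≥0∞, Measurable F →
        Measurable fun a : ℝ ↦ ∫⁻ v : Fin n → ℝ, F (Fin.cons a v) := fun F hF ↦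
      (hF.comp hcons).lintegral_prod_right'
    have hslice : ∀ F : (Fin (n + 1) → ℝ) → ℝ≥0∞, Measurable F → ∀ a : ℝ,
        Measurable fun v : Fin n → ℝ ↦ F (Fin.cons a v) := fun F hF a ↦
      (hF.comp hcons).comp measurable_prodMk_left
    rw [hfubini f hf, hfubini g hg, hfubini h hh]
    refine prekopa_leindler_real ht0 ht1 (hmeas f hf) (hmeas g hg) (hmeas h hh) fun a b ↦
      ih (hslice f hf a) (hslice g hg b) (hslice h hh _) fun v w ↦ (hfgh _ _).trans_eq ?_
    congr 1
    ext i
    refine Fin.cases ?_ (fun j ↦ ?_) i <;> simp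

/-- The multiplicative form of the **Brunn–Minkowski inequality**. -/
theorem volume_rpow_mul_volume_rpow_le {t : ℝ} (ht0 : 0 < t) (ht1 : t < 1) {n : ℕ}
    {P Q R : Set (EuclideanSpace ℝ (Fin n))} (hP : MeasurableSet P) (hQ : MeasurableSet Q)
    (hR : MeasurableSet R) (hPQR : (1 - t) • P + t • Q ⊆ R) :
    volume P ^ (1 - t) * volume Q ^ t ≤ volume R := by
  have hs : 0 < 1 - t := sub_pos.2 ht1
  have htoLp := PiLp.volume_preserving_toLp (Fin n)
  have hind : ∀ S : Set (EuclideanSpace ℝ (Fin n)), MeasurableSet S →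
      Measurable ((WithLp.toLp 2 ⁻¹' S).indicator (1 : (Fin n → ℝ) → ℝ≥0∞)) := fun S hS ↦
    measurable_one.indicator (htoLp.measurable hS)
  have key := prekopa_leindler ht0 ht1 (hind P hP) (hind Q hQ) (hind R hR) fun x y ↦ by
    by_cases hx : WithLp.toLp 2 x ∈ P
    · by_cases hy : WithLp.toLp 2 y ∈ Q
      · have hxy : WithLp.toLp 2 ((1 - t) • x + t • y) ∈ R :=
          hPQR ⟨_, smul_mem_smul_set hx, _, smul_mem_smul_set hy, rfl⟩
        rw [indicator_of_mem (s := WithLp.toLp 2 ⁻¹' R) hxy]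
        simp [indicator, hx, hy]
      · simp [indicator, hy, ht0]
    · simp [indicator, hx, hs]
  rwa [lintegral_indicator_one (htoLp.measurable hP), lintegral_indicator_one (htoLp.measurable hQ),
    lintegral_indicator_one (htoLp.measurable hR), htoLp.measure_preimage hP.nullMeasurableSet,
    htoLp.measure_preimage hQ.nullMeasurableSet,
    htoLp.measure_preimage hR.nullMeasurableSet] at key

/-- The **Brunn–Minkowski inequality**, where the volumes of the summands are expressed through
their volumetric radii relative to a common reference volume. -/
theorem ofReal_add_pow_mul_le_volume {n : ℕ} {P Q R : Set (EuclideanSpace ℝ (Fin n))}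
    (hP : MeasurableSet P) (hQ : MeasurableSet Q) (hR : MeasurableSet R) (hPQR : P + Q ⊆ R)
    {a b : ℝ} (ha : 0 < a) (hb : 0 < b) {κ : ℝ≥0∞}
    (hPa : volume P = ENNReal.ofReal (a ^ n) * κ) (hQb : volume Q = ENNReal.ofReal (b ^ n) * κ) :
    ENNReal.ofReal ((a + b) ^ n) * κ ≤ volume R := by
  have hab : 0 < a + b := add_pos ha hb
  have ht0 : 0 < b / (a + b) := div_pos hb hab
  have ht1 : b / (a + b) < 1 := (div_lt_one hab).2 (lt_add_of_pos_left b ha)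
  have hcancel : ∀ c : ℝ, 0 < c → ∀ v : ℝ≥0∞,
      ENNReal.ofReal (c ^ n) * (ENNReal.ofReal (c⁻¹ ^ n) * v) = v := fun c hc v ↦ by
    rw [← mul_assoc, ← ENNReal.ofReal_mul (by positivity), ← mul_pow, mul_inv_cancel₀ hc.ne',
      one_pow, ENNReal.ofReal_one, one_mul]
  have hsmul : ∀ c : ℝ, 0 < c → ∀ S : Set (EuclideanSpace ℝ (Fin n)),
      volume (c⁻¹ • S) = ENNReal.ofReal (c⁻¹ ^ n) * volume S := fun c hc S ↦ by
    rw [Measure.addHaar_smul_of_nonneg _ (inv_pos.2 hc).le, finrank_euclideanSpace_fin]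
  have hsub : (1 - b / (a + b)) • a⁻¹ • P + (b / (a + b)) • b⁻¹ • Q ⊆ (a + b)⁻¹ • R := by
    have h₁ : (1 - b / (a + b)) * a⁻¹ = (a + b)⁻¹ := by field_simp; ring
    have h₂ : b / (a + b) * b⁻¹ = (a + b)⁻¹ := by field_simp
    rw [smul_smul, smul_smul, h₁, h₂, ← smul_add]
    exact smul_set_mono hPQR
  have key := volume_rpow_mul_volume_rpow_le ht0 ht1 (hP.const_smul₀ a⁻¹) (hQ.const_smul₀ b⁻¹)
    (hR.const_smul₀ (a + b)⁻¹) hsub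
  rw [hsmul a ha, hsmul b hb, hsmul _ hab, hPa, hQb, mul_left_comm, hcancel a ha,
    mul_left_comm, hcancel b hb, ← ENNReal.rpow_add_of_nonneg _ _ (sub_pos.2 ht1).le ht0.le,
    sub_add_cancel, ENNReal.rpow_one] at key
  calc ENNReal.ofReal ((a + b) ^ n) * κ
      ≤ ENNReal.ofReal ((a + b) ^ n) * (ENNReal.ofReal ((a + b)⁻¹ ^ n) * volume R) := by gcongr
    _ = volume R := hcancel _ hab _

/-- If `K` is a generating o-symmetric convex body and `A` is a nonempty
compact set of positive volume with volumetric radius `rA` (so `rA^d · V(K) = V(A)`),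
then for all `r > rA`, `V(A_K^r) ≤ V(B_K[o, r − rA]) = (r − rA)^d · V(K)`. -/
theorem balls_are_volumetric_maximizers
    (d : ℕ) (hd : 1 < d)
    (K : Set (EuclideanSpace ℝ (Fin d)))
    (hKcomp : IsCompact K) (hKconv : Convex ℝ K)
    (hKint : (interior K).Nonempty) (hKsymm : ∀ x ∈ K, -x ∈ K)
    (hKgen : ∀ C : Set (EuclideanSpace ℝ (Fin d)), C.Nonempty →
      (⋂ x ∈ C, ({x} + K)).Nonempty →
      ∃ A'' : Set (EuclideanSpace ℝ (Fin d)), IsCompact A'' ∧ Convex ℝ A'' ∧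
        (⋂ x ∈ C, ({x} + K)) + A'' = K)
    (A : Set (EuclideanSpace ℝ (Fin d))) (hA : IsCompact A) (hAne : A.Nonempty)
    (hAvol : 0 < volume A)
    (rA : ℝ) (hrA0 : 0 ≤ rA)
    (hrA : ENNReal.ofReal (rA ^ d) * volume K = volume A) :
    ∀ r : ℝ, rA < r →
      volume (⋂ a ∈ A, ({a} + r • K)) ≤ volume ((r - rA) • K) ∧
      volume ((r - rA) • K) = ENNReal.ofReal ((r - rA) ^ d) * volume K := by
  intro r hr
  have hvol : ∀ c : ℝ, 0 ≤ c → volume (c • K) = ENNReal.ofReal (c ^ d) * volume K := fun c hc ↦ by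
    rw [Measure.addHaar_smul_of_nonneg _ hc, finrank_euclideanSpace_fin]
  have hrrA : 0 ≤ r - rA := (sub_pos.2 hr).le
  refine ⟨?_, hvol _ hrrA⟩
  set X := ⋂ a ∈ A, ({a} + r • K) with hX
  have hd0 : d ≠ 0 := by omega
  have hK0 : volume K ≠ 0 := (Measure.measure_pos_of_nonempty_interior volume hKint).ne'
  have hKtop : volume K ≠ ∞ := hKcomp.measure_lt_top.ne
  have hball : ∀ a, IsCompact ({a} + r • K) := fun a ↦ isCompact_singleton.add (hKcomp.smul r)
  have hXclosed : IsClosed X := isClosed_biInter fun a _ ↦ (hball a).isClosed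
  have hXtop : volume X ≠ ∞ := by
    obtain ⟨a, ha⟩ := hAne
    exact ((measure_mono (biInter_subset_of_mem ha)).trans_lt (hball a).measure_lt_top).ne
  have hrApos : 0 < rA := by
    refine hrA0.lt_of_ne fun h ↦ hAvol.ne ?_
    rw [← hrA, ← h, zero_pow hd0, ENNReal.ofReal_zero, zero_mul]
  have hsub : X + -A ⊆ r • K := by
    rintro _ ⟨x, hx, a, ha, rfl⟩
    obtain ⟨_, rfl, y, hy, hxy⟩ := mem_iInter₂.1 hx (-a) ha
    simpa [← hxy] using hy
  have hρd : (((volume X).toReal / (volume K).toReal) ^ (d⁻¹ : ℝ)) ^ d =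
      (volume X).toReal / (volume K).toReal := Real.rpow_inv_natCast_pow (by positivity) hd0
  have hρ0 : 0 ≤ ((volume X).toReal / (volume K).toReal) ^ (d⁻¹ : ℝ) := by positivity
  generalize ((volume X).toReal / (volume K).toReal) ^ (d⁻¹ : ℝ) = ρ at hρd hρ0
  have hXρ : volume X = ENNReal.ofReal (ρ ^ d) * volume K := by
    rw [hρd, ENNReal.ofReal_div_of_pos (ENNReal.toReal_pos hK0 hKtop),
      ENNReal.ofReal_toReal hXtop, ENNReal.ofReal_toReal hKtop, ENNReal.div_mul_cancel hK0 hKtop]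
  have hρ : ρ ≤ r - rA := by
    rcases hρ0.eq_or_lt with rfl | hρpos
    · exact hrrA
    have hBM := ofReal_add_pow_mul_le_volume hXclosed.measurableSet hA.neg.measurableSet
      (hKcomp.smul r).measurableSet hsub hρpos hrApos hXρ
      ((Measure.measure_neg volume A).trans hrA.symm)
    have hr0 : 0 ≤ r := hrA0.trans hr.le
    rw [hvol r hr0, ENNReal.mul_le_mul_iff_left hK0 hKtop,
      ENNReal.ofReal_le_ofReal_iff (by positivity), pow_le_pow_iff_left₀ (by positivity) hr0 hd0]
      at hBM
    linarith
  rw [hXρ, hvol _ hrrA]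
  gcongr
end

section
/- Let λ > 0, N ≥ 3^d, d > 1, let K be an origin-symmetric convex body in R^d which is a generating set, let r > cr_K(P), and let P = {p_1,...,p_N} satisfy ‖p_i − p_j‖_K ≥ λ for all i < j. Then V_d(P_K^r) ≤ (r − (N^{1/d} − 1)·λ/2)^d · V_d(K) ≤ (r − λ)^d V_d(K). -/
open MeasureTheory Set
open scoped Pointwise ENNReal

/-- The one-dimensional Brunn–Minkowski inequality. -/
theorem volume_add_volume_le_of_add_subset {A B S : Set ℝ} (hA : MeasurableSet A)
    (hB : MeasurableSet B) (hAn : A.Nonempty) (hBn : B.Nonempty) (hS : A + B ⊆ S) :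
    volume A + volume B ≤ volume S := by
  obtain ⟨x₀, hx₀⟩ := hAn
  obtain ⟨y₀, hy₀⟩ := hBn
  have key : ∀ K ⊆ A, IsCompact K → ∀ L ⊆ B, IsCompact L → K.Nonempty → L.Nonempty →
      volume K + volume L ≤ volume S := by
    intro K hKA hK L hLB hL hKn hLn
    obtain ⟨M, hMK, hM⟩ := hK.exists_isGreatest hKn
    obtain ⟨m, hmL, hm⟩ := hL.exists_isLeast hLn
    have hdisj : AEDisjoint volume (m +ᵥ K) (M +ᵥ L) := by
      refine measure_mono_null (t := {M + m}) ?_ (by simp)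
      rintro z ⟨⟨x, hx, rfl⟩, ⟨y, hy, hxy⟩⟩
      have h1 := hM hx
      have h2 := hm hy
      simp only [vadd_eq_add, mem_singleton_iff] at hxy ⊢
      linarith
    have hsub : (m +ᵥ K) ∪ (M +ᵥ L) ⊆ S := by
      refine Subset.trans ?_ hS
      rintro z (⟨x, hx, rfl⟩ | ⟨y, hy, rfl⟩)
      · exact ⟨x, hKA hx, m, hLB hmL, add_comm _ _⟩
      · exact ⟨M, hKA hMK, y, hLB hy, rfl⟩
    calc volume K + volume L = volume (m +ᵥ K) + volume (M +ᵥ L) := by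
          rw [measure_vadd, measure_vadd]
      _ = volume ((m +ᵥ K) ∪ (M +ᵥ L)) :=
          (measure_union₀ (hL.measurableSet.const_vadd M).nullMeasurableSet hdisj).symm
      _ ≤ volume S := measure_mono hsub
  refine le_of_forall_lt_imp_le_of_dense fun c hc => ?_
  have : ∃ K ⊆ A, IsCompact K ∧ ∃ L ⊆ B, IsCompact L ∧ c ≤ volume K + volume L := by
    by_contra! hcon
    refine hc.not_ge ?_
    rw [hA.measure_eq_iSup_isCompact, hB.measure_eq_iSup_isCompact]
    simp only [iSup_and']
    refine ENNReal.biSup_add_biSup_le' (p := fun K => K ⊆ A ∧ IsCompact K)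
      (q := fun K => K ⊆ B ∧ IsCompact K) ⟨∅, by simp⟩ ⟨∅, by simp⟩ ?_
    intro K hK L hL
    exact (hcon K hK.1 hK.2 L hL.1 hL.2).le
  obtain ⟨K, hKA, hK, L, hLB, hL, hcKL⟩ := this
  refine hcKL.trans (le_trans (add_le_add (measure_mono (subset_insert x₀ K))
    (measure_mono (subset_insert y₀ L))) ?_)
  exact key _ (insert_subset hx₀ hKA) (hK.insert x₀) _ (insert_subset hy₀ hLB) (hL.insert y₀)
    (insert_nonempty _ _) (insert_nonempty _ _)

theorem weighted_volume_le {a b : ℝ} (ha : 0 < a) (hb : 0 < b) {A B S : Set ℝ}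
    (hA : MeasurableSet A) (hB : MeasurableSet B) (hAn : A.Nonempty) (hBn : B.Nonempty)
    (hS : ∀ x ∈ A, ∀ y ∈ B, a * x + b * y ∈ S) :
    ENNReal.ofReal a * volume A + ENNReal.ofReal b * volume B ≤ volume S := by
  have h := volume_add_volume_le_of_add_subset (hA.const_smul₀ a) (hB.const_smul₀ b)
    (hAn.smul_set) (hBn.smul_set) (S := S) (by
      rintro _ ⟨_, ⟨x, hx, rfl⟩, _, ⟨y, hy, rfl⟩, rfl⟩
      exact hS x hx y hy)
  rw [Measure.addHaar_smul_of_nonneg _ ha.le, Measure.addHaar_smul_of_nonneg _ hb.le] at h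
  simpa using h

theorem lintegral_weighted_le_of_normalized {a b : ℝ} (ha : 0 < a) (hb : 0 < b) (hab : a + b = 1)
    {f g h : ℝ → ℝ} (hf : Measurable f) (hg : Measurable g) (hh : Measurable h)
    (hf0 : ∀ x, 0 ≤ f x) (hg0 : ∀ x, 0 ≤ g x) (hh0 : ∀ x, 0 ≤ h x)
    (hf1 : ∀ x, f x ≤ 1) (hg1 : ∀ x, g x ≤ 1)
    (hfs : ∀ t < 1, ∃ x, t < f x) (hgs : ∀ t < 1, ∃ x, t < g x)
    (hfgh : ∀ x y, f x ^ a * g y ^ b ≤ h (a * x + b * y)) :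
    ENNReal.ofReal a * (∫⁻ x, ENNReal.ofReal (f x)) +
      ENNReal.ofReal b * (∫⁻ x, ENNReal.ofReal (g x)) ≤ ∫⁻ x, ENNReal.ofReal (h x) := by
  have hmeas : ∀ {u : ℝ → ℝ}, Measurable fun t : ℝ => volume {x | t < u x} := fun {u} =>
    Antitone.measurable fun s t hst => measure_mono fun x (hx : t < u x) => hst.trans_lt hx
  rw [lintegral_eq_lintegral_meas_lt _ (.of_forall hf0) hf.aemeasurable,
    lintegral_eq_lintegral_meas_lt _ (.of_forall hg0) hg.aemeasurable,
    lintegral_eq_lintegral_meas_lt _ (.of_forall hh0) hh.aemeasurable,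
    ← lintegral_const_mul _ hmeas, ← lintegral_const_mul _ hmeas,
    ← lintegral_add_left (hmeas.const_mul _)]
  refine setLIntegral_mono hmeas fun t (ht : 0 < t) => ?_
  rcases lt_or_ge t 1 with ht1 | ht1
  · refine weighted_volume_le ha hb (measurableSet_lt measurable_const hf)
      (measurableSet_lt measurable_const hg) (hfs t ht1) (hgs t ht1) fun x hx y hy => ?_
    refine lt_of_lt_of_le ?_ (hfgh x y)
    calc t = t ^ a * t ^ b := by rw [← Real.rpow_add ht, hab, Real.rpow_one]
      _ < f x ^ a * g y ^ b := by
        have hx' : t < f x := hx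
        have hy' : t < g y := hy
        gcongr
  · have h1 : {x | t < f x} = ∅ := by
      ext x; simpa using (hf1 x).trans ht1
    have h2 : {x | t < g x} = ∅ := by
      ext x; simpa using (hg1 x).trans ht1
    simp [h1, h2]

theorem ENNReal.rpow_mul_rpow_le_weighted_add {a b : ℝ} (ha : 0 < a) (hb : 0 < b)
    (hab : a + b = 1) (U V : ℝ≥0∞) :
    U ^ a * V ^ b ≤ ENNReal.ofReal a * U + ENNReal.ofReal b * V := by
  have hpq : a⁻¹.HolderConjugate b⁻¹ := by
    rw [Real.holderConjugate_iff]
    refine ⟨(one_lt_inv₀ ha).2 (by linarith), by simpa using hab⟩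
  have h := ENNReal.young_inequality (U ^ a) (V ^ b) hpq
  rw [← ENNReal.rpow_mul, ← ENNReal.rpow_mul, mul_inv_cancel₀ ha.ne', mul_inv_cancel₀ hb.ne',
    ENNReal.rpow_one, ENNReal.rpow_one, ENNReal.ofReal_inv_of_pos ha, ENNReal.ofReal_inv_of_pos hb,
    div_eq_mul_inv, div_eq_mul_inv, inv_inv, inv_inv] at h
  rwa [mul_comm (ENNReal.ofReal a), mul_comm (ENNReal.ofReal b)]

/-- The Prékopa–Leindler inequality holds on `E`. -/
def PrekopaLeindler (E : Type*) [AddCommGroup E] [Module ℝ E] [MeasureSpace E] : Prop :=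
  ∀ ⦃a b : ℝ⦄, 0 < a → 0 < b → a + b = 1 → ∀ ⦃f g h : E → ℝ≥0∞⦄,
    Measurable f → Measurable g → Measurable h →
    (∀ x y, f x ^ a * g y ^ b ≤ h (a • x + b • y)) →
    (∫⁻ x, f x) ^ a * (∫⁻ x, g x) ^ b ≤ ∫⁻ x, h x

theorem prekopaLeindler_real_of_bounded {a b : ℝ} (ha : 0 < a) (hb : 0 < b) (hab : a + b = 1)
    {f g h : ℝ → ℝ≥0∞} (hf : Measurable f) (hg : Measurable g) (hh : Measurable h)
    (hfb : ⨆ x, f x ≠ ∞) (hgb : ⨆ x, g x ≠ ∞)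
    (hfgh : ∀ x y, f x ^ a * g y ^ b ≤ h (a * x + b * y)) :
    (∫⁻ x, f x) ^ a * (∫⁻ x, g x) ^ b ≤ ∫⁻ x, h x := by
  set F := ⨆ x, f x with hF
  set G := ⨆ x, g x with hG
  rcases eq_or_ne F 0 with hF0 | hF0
  · have : ∀ x, f x = 0 := by simpa [F] using hF0
    simp [this, ha]
  rcases eq_or_ne G 0 with hG0 | hG0
  · have : ∀ x, g x = 0 := by simpa [G] using hG0
    simp [this, hb]
  set H := F ^ a * G ^ b with hH
  have hFa0 : F ^ a ≠ 0 := by simp [ENNReal.rpow_eq_zero_iff, hF0, hfb]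
  have hGb0 : G ^ b ≠ 0 := by simp [ENNReal.rpow_eq_zero_iff, hG0, hgb]
  have hFat : F ^ a ≠ ∞ := ENNReal.rpow_ne_top_of_nonneg ha.le hfb
  have hGbt : G ^ b ≠ ∞ := ENNReal.rpow_ne_top_of_nonneg hb.le hgb
  have hH0 : H ≠ 0 := mul_ne_zero hFa0 hGb0
  have hHt : H ≠ ∞ := ENNReal.mul_ne_top hFat hGbt
  have hfF : ∀ x, f x / F ≤ 1 := fun x => ENNReal.div_le_of_le_mul (by simpa using le_iSup f x)
  have hgG : ∀ x, g x / G ≤ 1 := fun x => ENNReal.div_le_of_le_mul (by simpa using le_iSup g x)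
  have hft : ∀ x, f x / F ≠ ∞ := fun x => ((hfF x).trans_lt ENNReal.one_lt_top).ne
  have hgt : ∀ x, g x / G ≠ ∞ := fun x => ((hgG x).trans_lt ENNReal.one_lt_top).ne
  have hwt : ∀ x, min (h x / H) 1 ≠ ∞ := fun x =>
    ((min_le_right _ _).trans_lt ENNReal.one_lt_top).ne
  have hsup : ∀ {u : ℝ → ℝ≥0∞} {c : ℝ≥0∞}, c = ⨆ x, u x → c ≠ 0 → c ≠ ∞ →
      (∀ x, u x / c ≠ ∞) → ∀ t < (1 : ℝ), ∃ x, t < (u x / c).toReal := by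
    intro u c hc hc0 hct hut t ht
    rcases lt_or_ge t 0 with ht0 | ht0
    · exact ⟨0, ht0.trans_le ENNReal.toReal_nonneg⟩
    have h1 : ENNReal.ofReal t * c < ⨆ x, u x := by
      rw [← hc]
      calc ENNReal.ofReal t * c < 1 * c :=
            ENNReal.mul_lt_mul_left hc0 hct (by simpa using ht)
        _ = c := one_mul c
    obtain ⟨x, hx⟩ := lt_iSup_iff.1 h1
    refine ⟨x, (ENNReal.ofReal_lt_iff_lt_toReal ht0 (hut x)).1 ?_⟩
    exact (ENNReal.lt_div_iff_mul_lt (.inl hc0) (.inl hct)).2 hx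
  have key := lintegral_weighted_le_of_normalized ha hb hab
    (f := fun x => (f x / F).toReal) (g := fun x => (g x / G).toReal)
    (h := fun x => (min (h x / H) 1).toReal)
    (hf.div_const F).ennreal_toReal (hg.div_const G).ennreal_toReal
    ((hh.div_const H).min measurable_const).ennreal_toReal
    (fun _ => ENNReal.toReal_nonneg) (fun _ => ENNReal.toReal_nonneg)
    (fun _ => ENNReal.toReal_nonneg)
    (fun x => ENNReal.toReal_le_of_le_ofReal zero_le_one (by simpa using hfF x))
    (fun x => ENNReal.toReal_le_of_le_ofReal zero_le_one (by simpa using hgG x))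
    (hsup hF hF0 hfb hft) (hsup hG hG0 hgb hgt)
    (fun x y => by
      rw [ENNReal.toReal_rpow, ENNReal.toReal_rpow, ← ENNReal.toReal_mul]
      refine ENNReal.toReal_mono (hwt _) (le_min ?_ ?_)
      · rw [ENNReal.div_rpow_of_nonneg _ _ ha.le, ENNReal.div_rpow_of_nonneg _ _ hb.le,
          ENNReal.le_div_iff_mul_le (.inl hH0) (.inl hHt)]
        calc f x ^ a / F ^ a * (g y ^ b / G ^ b) * H
            = (f x ^ a / F ^ a * F ^ a) * (g y ^ b / G ^ b * G ^ b) := by rw [hH]; ring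
          _ = f x ^ a * g y ^ b := by
            rw [ENNReal.div_mul_cancel hFa0 hFat, ENNReal.div_mul_cancel hGb0 hGbt]
          _ ≤ _ := hfgh x y
      · calc (f x / F) ^ a * (g y / G) ^ b ≤ 1 * 1 :=
            mul_le_mul' (ENNReal.rpow_le_one (hfF x) ha.le) (ENNReal.rpow_le_one (hgG y) hb.le)
          _ = 1 := one_mul 1)
  simp only [ENNReal.ofReal_toReal (hft _), ENNReal.ofReal_toReal (hgt _),
    ENNReal.ofReal_toReal (hwt _)] at key
  have hdiv : ∀ {u : ℝ → ℝ≥0∞} (c : ℝ≥0∞), Measurable u → ∫⁻ x, u x / c = (∫⁻ x, u x) / c :=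
    fun c hu => by simp only [div_eq_mul_inv]; exact lintegral_mul_const _ hu
  rw [hdiv F hf, hdiv G hg] at key
  have h2 : (∫⁻ x, f x) ^ a * (∫⁻ x, g x) ^ b / H ≤ (∫⁻ x, h x) / H := by
    calc (∫⁻ x, f x) ^ a * (∫⁻ x, g x) ^ b / H
        = ((∫⁻ x, f x) / F) ^ a * ((∫⁻ x, g x) / G) ^ b := by
          rw [ENNReal.div_rpow_of_nonneg _ _ ha.le, ENNReal.div_rpow_of_nonneg _ _ hb.le, hH,
            div_eq_mul_inv, div_eq_mul_inv, div_eq_mul_inv,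
            ENNReal.mul_inv (.inl hFa0) (.inl hFat)]
          ring
      _ ≤ _ := ENNReal.rpow_mul_rpow_le_weighted_add ha hb hab _ _
      _ ≤ _ := key
      _ ≤ ∫⁻ x, h x / H := lintegral_mono fun x => min_le_left _ _
      _ = _ := hdiv H hh
  calc _ = (∫⁻ x, f x) ^ a * (∫⁻ x, g x) ^ b / H * H := (ENNReal.div_mul_cancel hH0 hHt).symm
    _ ≤ (∫⁻ x, h x) / H * H := by gcongr
    _ = _ := ENNReal.div_mul_cancel hH0 hHt

theorem prekopaLeindler_real : PrekopaLeindler ℝ := by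
  intro a b ha hb hab f g h hf hg hh hfgh
  have htrunc : ∀ {u : ℝ → ℝ≥0∞}, Measurable u →
      Filter.Tendsto (fun n : ℕ => ∫⁻ x, min (u x) n) Filter.atTop (nhds (∫⁻ x, u x)) := by
    intro u hu
    refine lintegral_tendsto_of_tendsto_of_monotone
      (fun n => (hu.min measurable_const).aemeasurable)
      (.of_forall fun x n m hnm => min_le_min_left _ (by exact_mod_cast hnm))
      (.of_forall fun x => ?_)
    simpa using tendsto_const_nhds.min (ENNReal.tendsto_nat_nhds_top) (f := fun _ => u x)
  have hb1 : ∀ (u : ℝ → ℝ≥0∞) (n : ℕ), ⨆ x, min (u x) n ≠ ∞ := fun u n =>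
    ((iSup_le fun x => min_le_right _ _).trans_lt (ENNReal.natCast_lt_top n)).ne
  have hbdd : ∀ n m : ℕ, (∫⁻ x, min (f x) n) ^ a * (∫⁻ x, min (g x) m) ^ b ≤ ∫⁻ x, h x := by
    intro n m
    refine prekopaLeindler_real_of_bounded ha hb hab (hf.min measurable_const)
      (hg.min measurable_const) hh (hb1 f n) (hb1 g m) fun x y => le_trans ?_ (hfgh x y)
    gcongr <;> exact min_le_left _ _
  have hsup : ∀ {u : ℝ → ℝ≥0∞}, Measurable u → ∫⁻ x, u x = ⨆ n : ℕ, ∫⁻ x, min (u x) n :=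
    fun hu => tendsto_nhds_unique (htrunc hu) (tendsto_atTop_iSup fun n m hnm =>
      lintegral_mono fun x => min_le_min_left _ (by exact_mod_cast hnm))
  have hpow : ∀ {s : ℕ → ℝ≥0∞} {c : ℝ}, 0 < c → (⨆ n, s n) ^ c = ⨆ n, s n ^ c :=
    fun hc => (ENNReal.orderIsoRpow _ hc).map_iSup _
  rw [hsup hf, hsup hg, hpow ha, hpow hb, ENNReal.iSup_mul]
  refine iSup_le fun n => ?_
  rw [ENNReal.mul_iSup]
  exact iSup_le fun m => hbdd n m

theorem PrekopaLeindler.prod {E F : Type*} [AddCommGroup E] [Module ℝ E] [MeasureSpace E]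
    [AddCommGroup F] [Module ℝ F] [MeasureSpace F] [SFinite (volume : Measure F)]
    [SFinite (volume : Measure E)]
    (hE : PrekopaLeindler E) (hF : PrekopaLeindler F) : PrekopaLeindler (E × F) := by
  intro a b ha hb hab f g h hf hg hh hfgh
  rw [Measure.volume_eq_prod, lintegral_prod _ hf.aemeasurable, lintegral_prod _ hg.aemeasurable,
    lintegral_prod _ hh.aemeasurable]
  refine hE ha hb hab hf.lintegral_prod_right' hg.lintegral_prod_right' hh.lintegral_prod_right'
    fun x y => ?_
  exact hF ha hb hab (hf.comp measurable_prodMk_left) (hg.comp measurable_prodMk_left)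
    (hh.comp measurable_prodMk_left) fun z w => hfgh (x, z) (y, w)

theorem PrekopaLeindler.of_measurePreserving {E F : Type*} [AddCommGroup E] [Module ℝ E]
    [MeasureSpace E] [AddCommGroup F] [Module ℝ F] [MeasureSpace F]
    (hE : PrekopaLeindler E) (e : E → F) (he : MeasurePreserving e)
    (hlin : ∀ (a b : ℝ) x y, e (a • x + b • y) = a • e x + b • e y) : PrekopaLeindler F := by
  intro a b ha hb hab f g h hf hg hh hfgh
  rw [← he.lintegral_comp hf, ← he.lintegral_comp hg, ← he.lintegral_comp hh]
  refine hE ha hb hab (hf.comp he.measurable) (hg.comp he.measurable) (hh.comp he.measurable)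
    fun x y => ?_
  simpa [hlin] using hfgh (e x) (e y)

theorem prekopaLeindler_pi (n : ℕ) : PrekopaLeindler (Fin n → ℝ) := by
  induction n with
  | zero =>
    intro a b ha hb hab f g h hf hg hh hfgh
    simp only [volume_pi, Measure.pi_of_empty (fun _ : Fin 0 => (volume : Measure ℝ)) 0]
    rw [lintegral_dirac' _ hf, lintegral_dirac' _ hg, lintegral_dirac' _ hh]
    simpa using hfgh 0 0
  | succ n ih =>
    refine (prekopaLeindler_real.prod ih).of_measurePreserving _
      (volume_preserving_piFinSuccAbove (fun _ : Fin (n + 1) => ℝ) 0).symm fun a b x y => ?_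
    ext i
    refine Fin.cases ?_ (fun j => ?_) i <;>
      simp [MeasurableEquiv.piFinSuccAbove, Fin.insertNthEquiv]

theorem prekopaLeindler_euclideanSpace (n : ℕ) : PrekopaLeindler (EuclideanSpace ℝ (Fin n)) :=
  (prekopaLeindler_pi n).of_measurePreserving _ (PiLp.volume_preserving_toLp (Fin n))
    fun a b x y => by simp

/-- The Brunn–Minkowski inequality for compact sets. -/
theorem brunnMinkowski_of_isCompact {d : ℕ} {A B : Set (EuclideanSpace ℝ (Fin d))}
    (hA : IsCompact A) (hB : IsCompact B) (hAn : A.Nonempty) (hBn : B.Nonempty) {α β : ℝ}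
    (hα : 0 ≤ α) (hβ : 0 ≤ β) (hαA : ENNReal.ofReal (α ^ d) ≤ volume A)
    (hβB : ENNReal.ofReal (β ^ d) ≤ volume B) :
    ENNReal.ofReal ((α + β) ^ d) ≤ volume (A + B) := by
  rcases hα.eq_or_lt with rfl | hα
  · obtain ⟨x, hx⟩ := hAn
    rw [zero_add]
    calc _ ≤ volume (x +ᵥ B) := by rwa [measure_vadd]
      _ ≤ _ := measure_mono (by rintro _ ⟨y, hy, rfl⟩; exact ⟨x, hx, y, hy, rfl⟩)
  rcases hβ.eq_or_lt with rfl | hβ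
  · obtain ⟨x, hx⟩ := hBn
    rw [add_zero]
    calc _ ≤ volume (x +ᵥ A) := by rwa [measure_vadd]
      _ ≤ _ := measure_mono (by rintro _ ⟨y, hy, rfl⟩; exact ⟨y, hy, x, hx, add_comm _ _⟩)
  have hαβ : 0 < α + β := by positivity
  have hone : ∀ {c : ℝ} {S : Set (EuclideanSpace ℝ (Fin d))}, 0 < c →
      ENNReal.ofReal (c ^ d) ≤ volume S → 1 ≤ volume (c⁻¹ • S) := by
    intro c S hc hS
    rw [Measure.addHaar_smul_of_nonneg _ (inv_nonneg.2 hc.le), finrank_euclideanSpace_fin]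
    calc (1 : ℝ≥0∞) = ENNReal.ofReal (c⁻¹ ^ d) * ENNReal.ofReal (c ^ d) := by
          rw [← ENNReal.ofReal_mul (by positivity), ← mul_pow, inv_mul_cancel₀ hc.ne']; simp
      _ ≤ _ := by gcongr
  have hmA := (hA.smul α⁻¹).measurableSet
  have hmB := (hB.smul β⁻¹).measurableSet
  have hmS := ((hA.add hB).smul (α + β)⁻¹).measurableSet
  have ha : 0 < α / (α + β) := by positivity
  have hb : 0 < β / (α + β) := by positivity
  have key := prekopaLeindler_euclideanSpace d ha hb (by field_simp)
    (f := (α⁻¹ • A).indicator 1) (g := (β⁻¹ • B).indicator 1)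
    (h := ((α + β)⁻¹ • (A + B)).indicator 1)
    (measurable_one.indicator hmA) (measurable_one.indicator hmB) (measurable_one.indicator hmS)
    (fun x y => by
      by_cases hx : x ∈ α⁻¹ • A
      swap
      · simp [hx, ha]
      by_cases hy : y ∈ β⁻¹ • B
      swap
      · simp [hy, hb]
      rw [indicator_of_mem hx, indicator_of_mem hy, indicator_of_mem]
      · simp
      · obtain ⟨x, hx, rfl⟩ := hx
        obtain ⟨y, hy, rfl⟩ := hy
        refine ⟨x + y, add_mem_add hx hy, ?_⟩
        simp only [smul_add, smul_smul]
        congr 2 <;> field_simp)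
  rw [lintegral_indicator_one hmA, lintegral_indicator_one hmB, lintegral_indicator_one hmS] at key
  have h1 : 1 ≤ volume ((α + β)⁻¹ • (A + B)) := by
    refine le_trans ?_ key
    calc (1 : ℝ≥0∞) = 1 ^ (α / (α + β)) * 1 ^ (β / (α + β)) := by simp
      _ ≤ _ := by gcongr <;> [exact hone hα hαA; exact hone hβ hβB]
  rw [Measure.addHaar_smul_of_nonneg _ (by positivity), finrank_euclideanSpace_fin] at h1
  calc ENNReal.ofReal ((α + β) ^ d)
      ≤ ENNReal.ofReal ((α + β) ^ d) * (ENNReal.ofReal ((α + β)⁻¹ ^ d) * volume (A + B)) :=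
        le_mul_of_one_le_right' h1
    _ = volume (A + B) := by
      rw [← mul_assoc, ← ENNReal.ofReal_mul (by positivity), ← mul_pow, mul_inv_cancel₀ hαβ.ne']
      simp

theorem mem_of_add_singleton_subset_add {E : Type*} [NormedAddCommGroup E] [NormedSpace ℝ E]
    {X A : Set E} (hX : IsCompact X) (hXn : X.Nonempty) (hA : IsClosed A) (hAc : Convex ℝ A)
    {b : E} (hb : X + {b} ⊆ X + A) : b ∈ A := by
  by_contra hbA
  obtain ⟨f, u, hfu, hub⟩ := geometric_hahn_banach_closed_point hAc hA hbA
  obtain ⟨x, hx, hmax⟩ := hX.exists_isMaxOn hXn f.continuous.continuousOn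
  obtain ⟨y, hy, z, hz, hyz⟩ := hb (add_mem_add hx (mem_singleton b))
  have h1 := congrArg f hyz
  have h2 : f y ≤ f x := hmax hy
  have h3 := hfu z hz
  simp only [map_add] at h1
  linarith

theorem zero_mem_interior_of_convex_symm {E : Type*} [NormedAddCommGroup E] [NormedSpace ℝ E]
    {K : Set E} (hKconv : Convex ℝ K) (hKint : (interior K).Nonempty)
    (hKsymm : ∀ x ∈ K, -x ∈ K) : (0 : E) ∈ interior K := by
  obtain ⟨x, hx⟩ := hKint
  have h := hKconv.combo_interior_self_mem_interior hx (hKsymm x (interior_subset hx))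
    (a := 1 / 2) (b := 1 / 2) (by norm_num) (by norm_num) (by norm_num)
  simpa using h

/-- Homothets `-p i + μ • K` whose centers have pairwise `K`-distance at least `2 * μ` form a
packing, so their volumes add up. -/
theorem card_mul_volume_le_of_packing {d N : ℕ} {K S : Set (EuclideanSpace ℝ (Fin d))}
    (hKconv : Convex ℝ K) (hK0 : (0 : EuclideanSpace ℝ (Fin d)) ∈ interior K)
    (hKsymm : ∀ x ∈ K, -x ∈ K) {μ : ℝ} (hμ : 0 < μ) {p : Fin N → EuclideanSpace ℝ (Fin d)}
    (hP : ∀ i j, i ≠ j → 2 * μ ≤ gauge K (p i - p j)) (hS : ∀ i, ∀ x ∈ K, -p i + μ • x ∈ S) :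
    N * (ENNReal.ofReal (μ ^ d) * volume K) ≤ volume S := by
  have habs : Absorbent ℝ K := absorbent_nhds_zero (mem_interior_iff_mem_nhds.1 hK0)
  have hdisj : Pairwise (Function.onFun Disjoint fun i => -p i +ᵥ μ • interior K) := by
    intro i j hij
    rw [Function.onFun, Set.disjoint_left]
    rintro z ⟨_, ⟨x, hx, rfl⟩, rfl⟩ ⟨_, ⟨y, hy, rfl⟩, hxy⟩
    have hxy' : -p j + μ • y = -p i + μ • x := hxy
    have heq : p i - p j = μ • (x + -y) := by
      rw [neg_add_eq_iff_eq_add, ← add_assoc, ← sub_eq_add_neg] at hxy'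
      rw [smul_add, smul_neg, hxy']
      abel
    have h1 : gauge K x < 1 := interior_subset_gauge_lt_one K hx
    have h2 : gauge K y < 1 := interior_subset_gauge_lt_one K hy
    have h3 := hP i j hij
    rw [heq, gauge_smul_of_nonneg hμ.le, smul_eq_mul] at h3
    have h4 := gauge_add_le hKconv habs x (-y)
    rw [gauge_neg hKsymm] at h4
    nlinarith
  have hvol : ∀ i, volume (-p i +ᵥ μ • interior K) = ENNReal.ofReal (μ ^ d) * volume K := by
    intro i
    rw [measure_vadd, Measure.addHaar_smul_of_nonneg _ hμ.le, finrank_euclideanSpace_fin,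
      measure_interior_of_null_frontier (hKconv.addHaar_frontier _)]
  calc N * (ENNReal.ofReal (μ ^ d) * volume K) = ∑ i, volume (-p i +ᵥ μ • interior K) := by
        simp [hvol]
    _ = volume (⋃ i, -p i +ᵥ μ • interior K) := by
      rw [measure_iUnion hdisj fun i =>
        ((isOpen_interior.smul₀ hμ.ne').vadd (-p i)).measurableSet, tsum_fintype]
    _ ≤ volume S := measure_mono <| iUnion_subset fun i => by
      rintro _ ⟨_, ⟨x, hx, rfl⟩, rfl⟩
      exact hS i x (interior_subset hx)

theorem exists_add_eq_smul_of_generating {ι E : Type*} [Nonempty ι] [NormedAddCommGroup E]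
    [NormedSpace ℝ E] {K : Set E}
    (hKgen : ∀ C : Set E, C.Nonempty → (⋂ x ∈ C, ({x} + K)).Nonempty →
      ∃ A : Set E, IsCompact A ∧ Convex ℝ A ∧ (⋂ x ∈ C, ({x} + K)) + A = K)
    {r : ℝ} (hr : 0 < r) (p : ι → E) (hX : (⋂ i, ({p i} + r • K)).Nonempty) :
    ∃ A : Set E, IsCompact A ∧ Convex ℝ A ∧ (⋂ i, ({p i} + r • K)) + A = r • K := by
  have heq : (⋂ x ∈ range fun i => r⁻¹ • p i, ({x} + K)) = r⁻¹ • ⋂ i, ({p i} + r • K) := by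
    rw [biInter_range, (show r⁻¹ • (⋂ i, ({p i} + r • K)) = ⋂ i, r⁻¹ • ({p i} + r • K) from
      image_iInter (MulAction.bijective₀ (inv_ne_zero hr.ne')) _)]
    simp only [smul_add, smul_set_singleton, inv_smul_smul₀ hr.ne']
  obtain ⟨A, hA, hAc, hXA⟩ := hKgen (range fun i => r⁻¹ • p i) (range_nonempty _)
    (by rw [heq]; exact hX.smul_set)
  refine ⟨r • A, hA.smul r, hAc.smul r, ?_⟩
  rw [← smul_inv_smul₀ hr.ne' (⋂ i, ({p i} + r • K)), ← heq, ← smul_add, hXA]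

theorem exists_lt_subset_of_sInf_lt {ι E : Type*} [Finite ι] [NormedAddCommGroup E]
    [NormedSpace ℝ E] {K : Set E} (hK0 : (0 : E) ∈ interior K) {r : ℝ} (p : ι → E)
    (hr : sInf {R : ℝ | 0 < R ∧ ∃ x : E, range p ⊆ {x} + R • K} < r) :
    ∃ R, 0 < R ∧ R < r ∧ ∃ x : E, range p ⊆ {x} + R • K := by
  have hne : {R : ℝ | 0 < R ∧ ∃ x : E, range p ⊆ {x} + R • K}.Nonempty := by
    obtain ⟨ε, hε, hball⟩ := Metric.isOpen_iff.1 isOpen_interior 0 hK0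
    obtain ⟨M, hM, hpM⟩ := (finite_range p).isBounded.exists_pos_norm_lt
    refine ⟨M / ε, div_pos hM hε, 0, ?_⟩
    intro y hy
    rw [singleton_zero, zero_add, mem_smul_set_iff_inv_smul_mem₀ (div_pos hM hε).ne']
    refine interior_subset (hball ?_)
    rw [mem_ball_zero_iff, norm_smul, inv_div, Real.norm_of_nonneg (by positivity)]
    rw [div_mul_eq_mul_div, div_lt_iff₀ hM]
    exact mul_lt_mul_of_pos_left (hpM y hy) hε
  obtain ⟨R, ⟨hR, hx⟩, hRr⟩ := exists_lt_of_csInf_lt hne hr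
  exact ⟨R, hR, hRr, hx⟩

/-- If `K` is a generating o-symmetric convex body, `N ≥ 3^d`, the points of
`P` have pairwise `K`-distances at least `λ`, and `r` exceeds the circumradius of `P`,
then `V(P_K^r) ≤ (r − (N^{1/d} − 1)·λ/2)^d · V(K) ≤ (r − λ)^d · V(K)`. -/
theorem intersection_volume_upper_bound
    (d N : ℕ) (hd : 1 < d) (hN : 3 ^ d ≤ N)
    (K : Set (EuclideanSpace ℝ (Fin d)))
    (hKcomp : IsCompact K) (hKconv : Convex ℝ K)
    (hKint : (interior K).Nonempty) (hKsymm : ∀ x ∈ K, -x ∈ K)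
    (hKgen : ∀ C : Set (EuclideanSpace ℝ (Fin d)), C.Nonempty →
      (⋂ x ∈ C, ({x} + K)).Nonempty →
      ∃ A'' : Set (EuclideanSpace ℝ (Fin d)), IsCompact A'' ∧ Convex ℝ A'' ∧
        (⋂ x ∈ C, ({x} + K)) + A'' = K)
    (r lam : ℝ) (hlam : 0 < lam)
    (p : Fin N → EuclideanSpace ℝ (Fin d))
    (hP : ∀ i j, i ≠ j → lam ≤ gauge K (p i - p j))
    (hr : sInf {R : ℝ | 0 < R ∧ ∃ x : EuclideanSpace ℝ (Fin d),
      range p ⊆ ({x} + R • K)} < r) :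
    volume (⋂ i, ({p i} + r • K)) ≤
      ENNReal.ofReal ((r - ((N : ℝ) ^ (1 / (d : ℝ)) - 1) * (lam / 2)) ^ d) * volume K ∧
    ENNReal.ofReal ((r - ((N : ℝ) ^ (1 / (d : ℝ)) - 1) * (lam / 2)) ^ d) * volume K ≤
      ENNReal.ofReal ((r - lam) ^ d) * volume K := by
  have hd0 : d ≠ 0 := by omega
  have hK0 := zero_mem_interior_of_convex_symm hKconv hKint hKsymm
  have : NeZero N := ⟨((by positivity : 0 < 3 ^ d).trans_le hN).ne'⟩
  obtain ⟨R, hR, hRr, x, hx⟩ := exists_lt_subset_of_sInf_lt hK0 p hr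
  have hr0 : 0 < r := hR.trans hRr
  set X := ⋂ i, ({p i} + r • K) with hXdef
  have hXn : X.Nonempty := by
    refine ⟨x, mem_iInter.2 fun i => ?_⟩
    obtain ⟨_, rfl, _, ⟨k, hk, rfl⟩, hxk⟩ := hx (mem_range_self i)
    have hmem : (R / r) • (-k) ∈ K :=
      hKconv.smul_mem_of_zero_mem (interior_subset hK0) (hKsymm k hk)
        ⟨by positivity, (div_le_one hr0).2 hRr.le⟩
    refine ⟨p i, rfl, _, smul_mem_smul_set hmem, ?_⟩
    dsimp only at hxk ⊢
    rw [← hxk, smul_smul, mul_div_cancel₀ _ hr0.ne', smul_neg, add_neg_cancel_right]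
  have hXcomp : IsCompact X :=
    (isCompact_singleton.add (hKcomp.smul r)).of_isClosed_subset
      (isClosed_iInter fun i => (isCompact_singleton.add (hKcomp.smul r)).isClosed)
      (iInter_subset _ 0)
  obtain ⟨A, hA, hAc, hXA⟩ := exists_add_eq_smul_of_generating hKgen hr0 p hXn
  have hpA : ∀ i, -p i ∈ A := fun i => by
    refine mem_of_add_singleton_subset_add hXcomp hXn hA.isClosed hAc ?_
    rw [hXA]
    rintro _ ⟨y, hy, _, rfl, rfl⟩
    obtain ⟨_, rfl, z, hz, rfl⟩ := mem_iInter.1 hy i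
    simpa using hz
  set B := A + (lam / 2) • K with hBdef
  have hB : IsCompact B := hA.add (hKcomp.smul _)
  have hBn : B.Nonempty := ⟨_, add_mem_add (hpA 0) (smul_mem_smul_set (interior_subset hK0))⟩
  have hXB : X + B = (r + lam / 2) • K := by
    rw [hBdef, ← add_assoc, hXA, hKconv.add_smul hr0.le (by positivity)]
  have hBvol : N * (ENNReal.ofReal ((lam / 2) ^ d) * volume K) ≤ volume B :=
    card_mul_volume_le_of_packing hKconv hK0 hKsymm (by positivity)
      (fun i j hij => by simpa [mul_div_cancel₀] using hP i j hij)
      fun i k hk => add_mem_add (hpA i) (smul_mem_smul_set hk)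
  set V := (volume K).toReal with hV
  have hVK : ENNReal.ofReal V = volume K := ENNReal.ofReal_toReal hKcomp.measure_lt_top.ne
  have hV0 : 0 < V := ENNReal.toReal_pos
    (Measure.measure_pos_of_nonempty_interior _ hKint).ne' hKcomp.measure_lt_top.ne
  set v := V ^ (1 / (d : ℝ)) with hv
  have hroot : ∀ {y : ℝ}, 0 ≤ y → (y ^ (1 / (d : ℝ))) ^ d = y := fun hy => by
    rw [one_div, Real.rpow_inv_natCast_pow hy hd0]
  have hv0 : 0 < v := Real.rpow_pos_of_pos hV0 _
  set n := (N : ℝ) ^ (1 / (d : ℝ)) with hn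
  have hn3 : 3 ≤ n := by
    refine le_of_pow_le_pow_left₀ hd0 (by positivity) ?_
    rw [hroot (by positivity)]
    exact_mod_cast hN
  set α := (volume X).toReal ^ (1 / (d : ℝ)) with hα
  have hα0 : 0 ≤ α := by positivity
  have hαX : ENNReal.ofReal (α ^ d) = volume X := by
    rw [hroot ENNReal.toReal_nonneg, ENNReal.ofReal_toReal hXcomp.measure_lt_top.ne]
  have hBM := brunnMinkowski_of_isCompact hXcomp hB hXn hBn hα0
    (β := n * (lam / 2) * v) (by positivity) hαX.le (by
      rw [mul_pow, mul_pow, hroot (by positivity), hroot hV0.le, mul_assoc,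
        ENNReal.ofReal_mul (by positivity), ENNReal.ofReal_mul (by positivity), hVK]
      simpa using hBvol)
  rw [hXB, Measure.addHaar_smul_of_nonneg _ (by positivity), finrank_euclideanSpace_fin, ← hVK,
    ← ENNReal.ofReal_mul (by positivity), ENNReal.ofReal_le_ofReal_iff (by positivity),
    ← hroot hV0.le, ← mul_pow] at hBM
  have hle : α + n * (lam / 2) * v ≤ (r + lam / 2) * v :=
    le_of_pow_le_pow_left₀ hd0 (by positivity) hBM
  have hαle : α ≤ (r - (n - 1) * (lam / 2)) * v := by linarith
  have hnonneg : 0 ≤ r - (n - 1) * (lam / 2) := nonneg_of_mul_nonneg_left (hα0.trans hαle) hv0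
  constructor
  · rw [← hαX, ← hVK, ← ENNReal.ofReal_mul (by positivity)]
    refine ENNReal.ofReal_le_ofReal ?_
    rw [← hroot hV0.le, ← mul_pow]
    exact pow_le_pow_left₀ hα0 hαle d
  · gcongr
    nlinarith
end
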